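/- (Rescaling at an isolated essential singularity, planar case) Let f : D \ {0} → ℂ ∪ {∞} be meromorphic with an essential singularity at 0. Then there exist a non-constant meromorphic function g : X → ℂ ∪ {∞} with X = ℂ or X = ℂ \ {0}, and sequences x_k → 0 in D \ {0} and ρ_k → 0 in (0,∞), such that f(x_k + ρ_k v) → g(v) locally uniformly on X with respect to the spherical metric. -/

import Mathlib

open Filter Topology Set OnePoint

/-- Chordal (spherical) distance on the Riemann sphere `ℂ ∪ {∞}`. -/
noncomputable def sdist (u v : OnePoint ℂ) : ℝ :=
  match u, v with
  | Option.some z, Option.some w =>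
      2 * dist z w / (Real.sqrt (1 + ‖z‖ ^ 2) * Real.sqrt (1 + ‖w‖ ^ 2))
  | Option.some z, Option.none => 2 / Real.sqrt (1 + ‖z‖ ^ 2)
  | Option.none, Option.some w => 2 / Real.sqrt (1 + ‖w‖ ^ 2)
  | Option.none, Option.none => 0

/-- A map to the Riemann sphere is meromorphic on `s`. -/
def MeromorphicToSphere (g : ℂ → OnePoint ℂ) (s : Set ℂ) : Prop :=
  ∀ z ∈ s, ∃ h : ℂ → ℂ, AnalyticAt ℂ h z ∧
    ((∀ᶠ w in 𝓝 z, g w = ((h w : ℂ) : OnePoint ℂ)) ∨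
     (g z = (∞ : OnePoint ℂ) ∧ h z = 0 ∧
       ∀ᶠ w in 𝓝[≠] z, g w = (((h w)⁻¹ : ℂ) : OnePoint ℂ)))


section Sphere

theorem sdist_cc (z w : ℂ) : sdist (z : OnePoint ℂ) (w : OnePoint ℂ) =
    2 * dist z w / (Real.sqrt (1 + ‖z‖ ^ 2) * Real.sqrt (1 + ‖w‖ ^ 2)) := rfl
theorem sdist_ci (z : ℂ) : sdist (z : OnePoint ℂ) ∞ = 2 / Real.sqrt (1 + ‖z‖ ^ 2) := rfl
theorem sdist_ic (z : ℂ) : sdist ∞ (z : OnePoint ℂ) = 2 / Real.sqrt (1 + ‖z‖ ^ 2) := rfl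
theorem sdist_ii : sdist (∞ : OnePoint ℂ) ∞ = 0 := rfl

/-- Stereographic embedding. -/
noncomputable def Phi (u : OnePoint ℂ) : WithLp 2 (ℂ × ℝ) :=
  u.elim (WithLp.toLp 2 ((0 : ℂ), (1 : ℝ)))
    (fun z => WithLp.toLp 2 (((2 / (1 + ‖z‖ ^ 2) : ℝ) : ℂ) * z, 1 - 2 / (1 + ‖z‖ ^ 2)))

theorem Phi_coe (z : ℂ) : Phi (z : OnePoint ℂ) =
  WithLp.toLp 2 (((2 / (1 + ‖z‖ ^ 2) : ℝ) : ℂ) * z, 1 - 2 / (1 + ‖z‖ ^ 2)) := rfl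
theorem Phi_inf : Phi ∞ = WithLp.toLp 2 ((0 : ℂ), (1 : ℝ)) := rfl

theorem dist_Phi_ci (z : ℂ) : dist (Phi (z : OnePoint ℂ)) (Phi ∞) =
    2 / Real.sqrt (1 + ‖z‖ ^ 2) := by
  rw [dist_eq_norm, WithLp.prod_norm_eq_of_L2, Phi_coe, Phi_inf]
  have h : 0 < 1 + ‖z‖ ^ 2 := by positivity
  rw [Real.sqrt_eq_iff_mul_self_eq (by positivity) (by positivity)]
  simp only [WithLp.sub_fst, WithLp.sub_snd, WithLp.toLp_fst, WithLp.toLp_snd, sub_zero, norm_mul, Complex.norm_real,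
    Real.norm_eq_abs, sq_abs, mul_pow]
  have h2 : Real.sqrt (1 + ‖z‖ ^ 2) ^ 2 = 1 + ‖z‖ ^ 2 := Real.sq_sqrt h.le
  rw [div_mul_div_comm, ← sq (Real.sqrt _), h2]
  field_simp
  ring

theorem dist_Phi_cc (z w : ℂ) : dist (Phi (z : OnePoint ℂ)) (Phi (w : OnePoint ℂ)) =
    2 * dist z w / (Real.sqrt (1 + ‖z‖ ^ 2) * Real.sqrt (1 + ‖w‖ ^ 2)) := by
  rw [dist_eq_norm, WithLp.prod_norm_eq_of_L2, Phi_coe, Phi_coe]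
  have h : 0 < 1 + ‖z‖ ^ 2 := by positivity
  have h' : 0 < 1 + ‖w‖ ^ 2 := by positivity
  rw [Real.sqrt_eq_iff_mul_self_eq (by positivity) (by positivity)]
  simp only [WithLp.sub_fst, WithLp.sub_snd, WithLp.toLp_fst, WithLp.toLp_snd, Real.norm_eq_abs, sq_abs]
  have h2 : Real.sqrt (1 + ‖z‖ ^ 2) ^ 2 = 1 + ‖z‖ ^ 2 := Real.sq_sqrt h.le
  have h3 : Real.sqrt (1 + ‖w‖ ^ 2) ^ 2 = 1 + ‖w‖ ^ 2 := Real.sq_sqrt h'.le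
  have e : (2 * dist z w / (Real.sqrt (1 + ‖z‖ ^ 2) * Real.sqrt (1 + ‖w‖ ^ 2))) *
    (2 * dist z w / (Real.sqrt (1 + ‖z‖ ^ 2) * Real.sqrt (1 + ‖w‖ ^ 2))) =
    4 * dist z w ^ 2 / ((1 + ‖z‖ ^ 2) * (1 + ‖w‖ ^ 2)) := by
    rw [← h2, ← h3, h2, h3]; rw [div_mul_div_comm]; congr 1
    · ring
    · rw [← sq, mul_pow, h2, h3]
  rw [e, dist_eq_norm]
  clear e h2 h3
  simp only [Complex.sq_norm, Complex.normSq_apply, Complex.sub_re, Complex.sub_im, Complex.mul_re, Complex.mul_im,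
    Complex.ofReal_re, Complex.ofReal_im] at h h' ⊢
  field_simp
  ring

theorem dist_Phi (u v : OnePoint ℂ) : dist (Phi u) (Phi v) = sdist u v := by
  induction u using OnePoint.rec <;> induction v using OnePoint.rec
  · rw [dist_self, sdist_ii]
  · rw [dist_comm, dist_Phi_ci, sdist_ic]
  · rw [dist_Phi_ci, sdist_ci]
  · rw [dist_Phi_cc, sdist_cc]

theorem Phi_inj : Function.Injective Phi := by
  intro u v h
  have h0 : sdist u v = 0 := by rw [← dist_Phi, h, dist_self]
  induction u using OnePoint.rec <;> induction v using OnePoint.rec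
  · rfl
  · rw [sdist_ic] at h0; exact absurd h0 (by positivity)
  · rw [sdist_ci] at h0; exact absurd h0 (by positivity)
  · rename_i z w
    rw [sdist_cc] at h0
    have : 0 < (Real.sqrt (1 + ‖z‖ ^ 2) * Real.sqrt (1 + ‖w‖ ^ 2)) := by positivity
    rw [div_eq_zero_iff] at h0
    rcases h0 with h0 | h0
    · simpa using h0
    · exact absurd h0 this.ne'

theorem Phi_cont : Continuous Phi := by
  rw [OnePoint.continuous_iff]
  constructor
  · rw [tendsto_iff_dist_tendsto_zero]
    simp_rw [dist_Phi_ci]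
    rw [Filter.coclosedCompact_eq_cocompact]
    have h1 : Tendsto (fun x : ℂ => ‖x‖ ^ 2) (cocompact ℂ) atTop :=
      (tendsto_pow_atTop two_ne_zero).comp (tendsto_norm_cocompact_atTop)
    have h2 := Real.tendsto_sqrt_atTop.comp (tendsto_atTop_add_const_left _ 1 h1)
    exact h2.const_div_atTop 2
  · have : ∀ z : ℂ, (1 + ‖z‖ ^ 2) ≠ 0 := fun z => by positivity
    have h : Continuous (fun z : ℂ =>
      ((((2 / (1 + ‖z‖ ^ 2) : ℝ) : ℂ) * z, 1 - 2 / (1 + ‖z‖ ^ 2)) : ℂ × ℝ)) := by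
      fun_prop (disch := assumption)
    exact (WithLp.prod_continuous_toLp 2 ℂ ℝ).comp h

theorem Phi_emb : IsEmbedding Phi :=
  (Phi_cont.isClosedEmbedding Phi_inj).isEmbedding

/-- The chordal metric. -/
@[reducible] noncomputable def sphereMetric : MetricSpace (OnePoint ℂ) :=
  Phi_emb.comapMetricSpace Phi

attribute [local instance] sphereMetric

theorem dist_sph (u v : OnePoint ℂ) : dist u v = sdist u v := dist_Phi u v

/-- inversion -/
noncomputable def sinv (u : OnePoint ℂ) : OnePoint ℂ :=
  u.elim ((0 : ℂ) : OnePoint ℂ) (fun z => if z = 0 then ∞ else ((z⁻¹ : ℂ) : OnePoint ℂ))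

theorem sinv_inf : sinv ∞ = ((0 : ℂ) : OnePoint ℂ) := rfl
theorem sinv_zero : sinv ((0 : ℂ) : OnePoint ℂ) = ∞ := by
  change (if (0 : ℂ) = 0 then _ else _) = _; simp
theorem sinv_coe {z : ℂ} (hz : z ≠ 0) : sinv (z : OnePoint ℂ) = ((z⁻¹ : ℂ) : OnePoint ℂ) := by
  change (if z = 0 then _ else _) = _; simp [hz]

theorem sinv_sinv (u : OnePoint ℂ) : sinv (sinv u) = u := by
  induction u using OnePoint.rec with
  | infty => rw [sinv_inf, sinv_zero]
  | coe z =>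
    by_cases hz : z = 0
    · rw [hz, sinv_zero, sinv_inf]
    · rw [sinv_coe hz, sinv_coe (inv_ne_zero hz), inv_inv]

theorem sqrt_inv_aux {z : ℂ} (hz : z ≠ 0) :
    Real.sqrt (1 + ‖z⁻¹‖ ^ 2) = Real.sqrt (1 + ‖z‖ ^ 2) / ‖z‖ := by
  have : 0 < ‖z‖ := norm_pos_iff.2 hz
  rw [eq_comm, div_eq_iff this.ne', ← Real.sqrt_sq this.le, ← Real.sqrt_mul (by positivity),
    Real.sqrt_sq this.le, norm_inv]
  congr 1
  field_simp
  ring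

theorem dist_sinv (u v : OnePoint ℂ) : dist (sinv u) (sinv v) = dist u v := by
  have key : ∀ z : ℂ, dist (sinv (z : OnePoint ℂ)) (sinv ∞) = dist (z : OnePoint ℂ) ∞ := by
    intro z
    rw [sinv_inf, dist_sph, dist_sph]
    by_cases hz : z = 0
    · rw [hz, sinv_zero, sdist_ic, sdist_ci]
    · have : 0 < ‖z‖ := norm_pos_iff.2 hz
      rw [sinv_coe hz, sdist_cc, sdist_ci, sqrt_inv_aux hz]
      simp
      field_simp
  have key0 : ∀ z : ℂ, dist (sinv (z : OnePoint ℂ)) (sinv (0 : ℂ)) =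
      dist (z : OnePoint ℂ) (0 : ℂ) := by
    intro z
    by_cases hz : z = 0
    · rw [hz, dist_self, dist_self]
    · have := key z⁻¹
      rw [sinv_inf, ← sinv_coe hz, sinv_sinv] at this
      rw [sinv_zero, this]
  induction u using OnePoint.rec with
  | infty =>
    induction v using OnePoint.rec with
    | infty => rw [dist_self, dist_self]
    | coe w => rw [dist_comm, key, dist_comm]
  | coe z =>
    induction v using OnePoint.rec with
    | infty => exact key z
    | coe w =>
      by_cases hw : w = 0
      · rw [hw, key0]
      by_cases hz : z = 0
      · rw [hz, dist_comm, key0, dist_comm]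
      have h1 : 0 < ‖z‖ := norm_pos_iff.2 hz
      have h2 : 0 < ‖w‖ := norm_pos_iff.2 hw
      rw [sinv_coe hz, sinv_coe hw, dist_sph, dist_sph, sdist_cc, sdist_cc,
        sqrt_inv_aux hz, sqrt_inv_aux hw]
      have : dist z⁻¹ w⁻¹ = dist z w / (‖z‖ * ‖w‖) := by
        rw [dist_inv_inv₀ hz hw]
      rw [this]
      field_simp

theorem sinv_cont : Continuous sinv :=
  (Isometry.of_dist_eq dist_sinv).continuous

theorem dist_le_two_mul (a b : ℂ) : dist (a : OnePoint ℂ) b ≤ 2 * dist a b := by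
  rw [dist_sph, sdist_cc]
  apply div_le_self (by positivity)
  have h1 : 1 ≤ Real.sqrt (1 + ‖a‖ ^ 2) := Real.one_le_sqrt.2 (by nlinarith [sq_nonneg ‖a‖])
  have h2 : 1 ≤ Real.sqrt (1 + ‖b‖ ^ 2) := Real.one_le_sqrt.2 (by nlinarith [sq_nonneg ‖b‖])
  nlinarith

theorem dist_cc_le {a b : ℂ} {A B : ℝ} (ha : ‖a‖ ≤ A) (hb : ‖b‖ ≤ B) :
    2 * dist a b ≤ (1 + A) * (1 + B) * dist (a : OnePoint ℂ) b := by
  have hA : 0 ≤ A := (norm_nonneg _).trans ha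
  have hB : 0 ≤ B := (norm_nonneg _).trans hb
  rw [dist_sph, sdist_cc]
  have h1 : Real.sqrt (1 + ‖a‖ ^ 2) ≤ 1 + A := by
    rw [Real.sqrt_le_left (by positivity)]; nlinarith [norm_nonneg a]
  have h2 : Real.sqrt (1 + ‖b‖ ^ 2) ≤ 1 + B := by
    rw [Real.sqrt_le_left (by positivity)]; nlinarith [norm_nonneg b]
  have h0 : 0 < (Real.sqrt (1 + ‖a‖ ^ 2) * Real.sqrt (1 + ‖b‖ ^ 2)) := by positivity
  have h3 : (Real.sqrt (1 + ‖a‖ ^ 2) * Real.sqrt (1 + ‖b‖ ^ 2)) ≤ (1 + A) * (1 + B) := by gcongr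
  rw [mul_div_assoc', le_div_iff₀ h0, mul_comm]
  gcongr

/-- closeness to a point of the closed unit disc forces finiteness and norm at most two -/
theorem near_unit {a : ℂ} (ha : ‖a‖ ≤ 1) {u : OnePoint ℂ} (h : dist u a ≤ 1 / 2) :
    ∃ b : ℂ, u = b ∧ ‖b‖ ≤ 2 := by
  have h1 : Real.sqrt (1 + ‖a‖ ^ 2) ≤ 3 / 2 := by
    rw [Real.sqrt_le_left (by positivity)]; nlinarith [norm_nonneg a]
  have h0 : 0 < Real.sqrt (1 + ‖a‖ ^ 2) := by positivity
  induction u using OnePoint.rec with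
  | infty =>
    rw [dist_sph, sdist_ic, div_le_iff₀ h0] at h
    linarith
  | coe b =>
    refine ⟨b, rfl, ?_⟩
    rw [dist_sph, sdist_cc, div_le_iff₀ (by positivity)] at h
    by_contra hb
    push Not at hb
    have h2 : Real.sqrt (1 + ‖b‖ ^ 2) ≤ 5 / 4 * ‖b‖ := by
      rw [Real.sqrt_le_left (by positivity)]; nlinarith [norm_nonneg b]
    have h3 : ‖b‖ - ‖a‖ ≤ dist b a := by rw [dist_eq_norm]; exact norm_sub_norm_le b a
    have h4 : Real.sqrt (1 + ‖b‖ ^ 2) * Real.sqrt (1 + ‖a‖ ^ 2) ≤ (5 / 4 * ‖b‖) * (3 / 2) := by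
      gcongr
    linarith

theorem unit_or (u : OnePoint ℂ) :
    (∃ a : ℂ, ‖a‖ ≤ 1 ∧ u = a) ∨ (∃ a : ℂ, ‖a‖ ≤ 1 ∧ sinv u = a) := by
  induction u using OnePoint.rec with
  | infty => exact Or.inr ⟨0, by simp, sinv_inf⟩
  | coe z =>
    rcases le_total ‖z‖ 1 with h | h
    · exact Or.inl ⟨z, h, rfl⟩
    · have : z ≠ 0 := by rintro rfl; norm_num at h
      exact Or.inr ⟨z⁻¹, by rw [norm_inv]; exact inv_le_one_of_one_le₀ h, sinv_coe this⟩

open Metric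

/-- Holomorphic map to the sphere at a point. -/
def Hol (g : ℂ → OnePoint ℂ) (z : ℂ) : Prop :=
  (∃ h : ℂ → ℂ, AnalyticAt ℂ h z ∧ ∀ᶠ w in 𝓝 z, g w = (h w : OnePoint ℂ)) ∨
  (∃ h : ℂ → ℂ, AnalyticAt ℂ h z ∧ ∀ᶠ w in 𝓝 z, sinv (g w) = (h w : OnePoint ℂ))

theorem Hol.sinv {g : ℂ → OnePoint ℂ} {z : ℂ} (h : Hol g z) : Hol (fun w => sinv (g w)) z := by
  rcases h with h | h
  · right; simpa only [sinv_sinv] using h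
  · left; exact h

theorem cont_aux {g : ℂ → OnePoint ℂ} {h : ℂ → ℂ} {z : ℂ} (ha : AnalyticAt ℂ h z)
    (he : ∀ᶠ w in 𝓝 z, g w = (h w : OnePoint ℂ)) : ContinuousAt g z := by
  have h1 : ContinuousAt (fun w => (h w : OnePoint ℂ)) z :=
    OnePoint.continuous_coe.continuousAt.comp ha.continuousAt
  exact h1.congr (he.mono fun w hw => hw.symm)

theorem Hol.continuousAt {g : ℂ → OnePoint ℂ} {z : ℂ} (h : Hol g z) : ContinuousAt g z := by
  rcases h with ⟨h, ha, he⟩ | ⟨h, ha, he⟩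
  · exact cont_aux ha he
  · have h1 := cont_aux (g := fun w => _root_.sinv (g w)) ha he
    have h2 := sinv_cont.continuousAt.comp h1
    simpa only [Function.comp_def, sinv_sinv] using h2

theorem Hol.diff {g : ℂ → OnePoint ℂ} {z : ℂ} (hg : Hol g z) {h : ℂ → ℂ}
    (he : ∀ᶠ w in 𝓝 z, g w = (h w : OnePoint ℂ)) : DifferentiableAt ℂ h z := by
  rcases hg with ⟨k, ka, ke⟩ | ⟨k, ka, ke⟩
  · refine ka.differentiableAt.congr_of_eventuallyEq ?_
    filter_upwards [he, ke] with w h1 h2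
    rw [h1] at h2; exact OnePoint.coe_injective h2
  · have key : ∀ᶠ w in 𝓝 z, k w ≠ 0 ∧ h w = (k w)⁻¹ := by
      filter_upwards [he, ke] with w h1 h2
      rw [h1] at h2
      have h3 : (h w : OnePoint ℂ) = _root_.sinv (k w : OnePoint ℂ) := by rw [← h2, sinv_sinv]
      by_cases h0 : k w = 0
      · rw [h0, sinv_zero] at h3; exact absurd h3 (OnePoint.coe_ne_infty _)
      · rw [sinv_coe h0] at h3; exact ⟨h0, OnePoint.coe_injective h3⟩
    have h0 := key.self_of_nhds.1
    refine (ka.differentiableAt.inv h0).congr_of_eventuallyEq ?_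
    filter_upwards [key] with w hw using hw.2

/-- finite part -/
noncomputable def toC (u : OnePoint ℂ) : ℂ := u.elim 0 id
theorem toC_coe (z : ℂ) : toC (z : OnePoint ℂ) = z := rfl

theorem schwarz_aux {g : ℂ → OnePoint ℂ} {v : ℂ} {r : ℝ} (hr : 0 < r)
    (hH : ∀ w ∈ ball v r, Hol g w) (hd : ∀ w ∈ ball v r, dist (g w) (g v) ≤ 1 / 2)
    {a : ℂ} (ha : ‖a‖ ≤ 1) (hga : g v = a) :
    ∀ w ∈ ball v r, dist (g w) (g v) ≤ 8 / r * dist w v := by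
  have hb : ∀ w ∈ ball v r, g w = (toC (g w) : OnePoint ℂ) ∧ ‖toC (g w)‖ ≤ 2 := by
    intro w hw
    obtain ⟨b, hb, hb2⟩ := near_unit ha (hga ▸ hd w hw)
    rw [hb, toC_coe]; exact ⟨rfl, hb2⟩
  have hv : v ∈ ball v r := mem_ball_self hr
  have hdiff : DifferentiableOn ℂ (fun w => toC (g w)) (ball v r) := by
    intro w hw
    refine (Hol.diff (hH w hw) ?_).differentiableWithinAt
    filter_upwards [isOpen_ball.mem_nhds hw] with u hu using (hb u hu).1
  have hmap : MapsTo (fun w => toC (g w)) (ball v r) (closedBall (toC (g v)) 4) := by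
    intro w hw
    rw [mem_closedBall, dist_eq_norm]
    have := norm_sub_le (toC (g w)) (toC (g v))
    linarith [(hb w hw).2, (hb v hv).2]
  intro w hw
  have h1 := Complex.dist_le_div_mul_dist_of_mapsTo_ball hdiff hmap hw
  rw [(hb w hw).1, (hb v hv).1]
  refine (dist_le_two_mul _ _).trans ?_
  calc 2 * dist (toC (g w)) (toC (g v)) ≤ 2 * (4 / r * dist w v) := by gcongr
    _ = 8 / r * dist w v := by ring

theorem schwarz {g : ℂ → OnePoint ℂ} {v : ℂ} {r : ℝ} (hr : 0 < r)
    (hH : ∀ w ∈ ball v r, Hol g w) (hd : ∀ w ∈ ball v r, dist (g w) (g v) ≤ 1 / 2) :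
    ∀ w ∈ ball v r, dist (g w) (g v) ≤ 8 / r * dist w v := by
  rcases unit_or (g v) with ⟨a, ha, hga⟩ | ⟨a, ha, hga⟩
  · exact schwarz_aux hr hH hd ha hga
  · have := schwarz_aux (g := fun w => sinv (g w)) hr (fun w hw => (hH w hw).sinv)
      (fun w hw => by rw [dist_sinv]; exact hd w hw) ha hga
    simpa only [dist_sinv] using this

theorem limHol {g : ℕ → ℂ → OnePoint ℂ} {G : ℂ → OnePoint ℂ} {v : ℂ} {s : ℝ} (hs : 0 < s)
    (hH : ∀ᶠ k in atTop, ∀ y ∈ ball v s, Hol (g k) y)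
    (hu : TendstoUniformlyOn g G atTop (ball v s))
    {a : ℂ} (ha : ‖a‖ ≤ 1) (hga : G v = a)
    (hd : ∀ y ∈ ball v s, dist (G y) (G v) ≤ 1 / 4) :
    ∃ h : ℂ → ℂ, AnalyticAt ℂ h v ∧ ∀ᶠ w in 𝓝 v, G w = (h w : OnePoint ℂ) := by
  have hG : ∀ w ∈ ball v s, G w = (toC (G w) : OnePoint ℂ) ∧ ‖toC (G w)‖ ≤ 2 := by
    intro w hw
    obtain ⟨b, hb, hb2⟩ := near_unit ha (u := G w) (by
      have := hd w hw; rw [hga] at this; linarith)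
    rw [hb, toC_coe]; exact ⟨rfl, hb2⟩
  rw [Metric.tendstoUniformlyOn_iff] at hu
  have hg : ∀ᶠ k in atTop, ∀ w ∈ ball v s, g k w = (toC (g k w) : OnePoint ℂ) ∧
      ‖toC (g k w)‖ ≤ 2 := by
    filter_upwards [hu (1 / 4) (by norm_num)] with k hk w hw
    obtain ⟨b, hb, hb2⟩ := near_unit ha (u := g k w) (by
      have h1 := hd w hw; have h2 := hk w hw; rw [hga] at h1
      have h3 := dist_triangle (g k w) (G w) a
      rw [dist_comm] at h2
      linarith)
    rw [hb, toC_coe]; exact ⟨rfl, hb2⟩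
  have hdiff : ∀ᶠ k in atTop, DifferentiableOn ℂ (fun w => toC (g k w)) (ball v s) := by
    filter_upwards [hg, hH] with k hk hHk w hw
    refine (Hol.diff (hHk w hw) ?_).differentiableWithinAt
    filter_upwards [isOpen_ball.mem_nhds hw] with u hu using (hk u hu).1
  have hunif : TendstoUniformlyOn (fun k w => toC (g k w)) (fun w => toC (G w)) atTop
      (ball v s) := by
    rw [Metric.tendstoUniformlyOn_iff]
    intro ε hε
    filter_upwards [hg, hu (ε / 9) (by positivity)] with k hk huk w hw
    have h1 := dist_cc_le (hG w hw).2 (hk w hw).2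
    rw [← (hG w hw).1, ← (hk w hw).1] at h1
    have := huk w hw
    linarith
  have hD := hunif.tendstoLocallyUniformlyOn.differentiableOn hdiff isOpen_ball
  refine ⟨fun w => toC (G w), hD.analyticAt (ball_mem_nhds v hs), ?_⟩
  filter_upwards [ball_mem_nhds v hs] with w hw using (hG w hw).1

theorem normal_seq {X : Set ℂ} (hX : IsOpen X) (g : ℕ → ℂ → OnePoint ℂ)
    (H : ∀ v ∈ X, ∃ r > 0, ∀ᶠ k in atTop, ∀ w ∈ ball v r,
      Hol (g k) w ∧ dist (g k w) (g k v) ≤ 1 / 2) :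
    ∃ φ : ℕ → ℕ, StrictMono φ ∧ ∃ G : ℂ → OnePoint ℂ, (∀ v ∈ X, Hol G v) ∧
      TendstoLocallyUniformlyOn (fun k => g (φ k)) G atTop X := by
  have equi : ∀ v ∈ X, ∀ ε > 0, ∃ s > 0, ball v s ⊆ X ∧
      ∀ᶠ k in atTop, ∀ w ∈ ball v s, Hol (g k) w ∧ dist (g k w) (g k v) < ε := by
    intro v hv ε hε
    obtain ⟨r, hr, hk⟩ := H v hv
    obtain ⟨t, ht, htX⟩ := Metric.isOpen_iff.1 hX v hv
    refine ⟨min t (min r (ε * r / 8)), by positivity,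
      (ball_subset_ball (min_le_left _ _)).trans htX, ?_⟩
    filter_upwards [hk] with k hk w hw
    have hw' := mem_ball.1 hw
    have hwr : w ∈ ball v r := by
      rw [mem_ball]; exact hw'.trans_le ((min_le_right _ _).trans (min_le_left _ _))
    have hwe : dist w v < ε * r / 8 :=
      hw'.trans_le ((min_le_right _ _).trans (min_le_right _ _))
    refine ⟨(hk w hwr).1, ?_⟩
    refine (schwarz hr (fun w hw => (hk w hw).1) (fun w hw => (hk w hw).2) w hwr).trans_lt ?_
    calc 8 / r * dist w v < 8 / r * (ε * r / 8) := by gcongr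
      _ = ε := by field_simp
  obtain ⟨a, φ, hφ, hlim⟩ := CompactSpace.tendsto_subseq
    (fun k => (fun n => g k (TopologicalSpace.denseSeq ℂ n) : ℕ → OnePoint ℂ))
  rw [tendsto_pi_nhds] at hlim
  have hlim2 : ∀ v ∈ X, ∃ L, Tendsto (fun k => g (φ k) v) atTop (𝓝 L) := by
    intro v hv
    apply cauchySeq_tendsto_of_complete
    rw [Metric.cauchySeq_iff]
    intro ε hε
    obtain ⟨s, hs, -, hk⟩ := equi v hv (ε / 4) (by positivity)
    obtain ⟨n, hn⟩ := (TopologicalSpace.denseRange_denseSeq ℂ).exists_dist_lt v hs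
    have h1 := (Metric.tendsto_nhds.1 (hlim n)) (ε / 4) (by positivity)
    have h2 := hφ.tendsto_atTop.eventually hk
    obtain ⟨N, hN⟩ := eventually_atTop.1 (h1.and h2)
    have h3 : ∀ m ≥ N, dist (g (φ m) v) (a n) < ε / 2 := by
      intro m hm
      obtain ⟨h4, h5⟩ := hN m hm
      have h6 := (h5 _ (by rw [mem_ball, dist_comm]; exact hn)).2
      have h7 := dist_triangle (g (φ m) v) (g (φ m) (TopologicalSpace.denseSeq ℂ n)) (a n)
      rw [dist_comm] at h6
      simp only [Function.comp] at h4
      linarith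
    refine ⟨N, fun m hm n' hn' => ?_⟩
    have := dist_triangle_right (g (φ m) v) (g (φ n') v) (a n)
    linarith [h3 m hm, h3 n' hn']
  choose! G hG using hlim2
  have main : ∀ v ∈ X, ∀ ε > 0, ∃ s > 0, ball v s ⊆ X ∧
      (∀ᶠ k in atTop, ∀ w ∈ ball v s, Hol (g (φ k)) w ∧ dist (G w) (g (φ k) w) < ε) ∧
      (∀ w ∈ ball v s, dist (G w) (G v) ≤ ε) := by
    intro v hv ε hε
    obtain ⟨s, hs, hsX, hk⟩ := equi v hv (ε / 4) (by positivity)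
    have h2 := hφ.tendsto_atTop.eventually hk
    have h3 : ∀ w ∈ ball v s, dist (G w) (G v) ≤ ε / 4 := by
      intro w hw
      refine le_of_tendsto ((hG w (hsX hw)).dist (hG v hv)) ?_
      filter_upwards [h2] with k hk using (hk w hw).2.le
    refine ⟨s, hs, hsX, ?_, fun w hw => (h3 w hw).trans (by linarith)⟩
    filter_upwards [h2, Metric.tendsto_nhds.1 (hG v hv) (ε / 4) (by positivity)] with k h4 h5 w hw
    refine ⟨(h4 w hw).1, ?_⟩
    have h6 := (h4 w hw).2
    have h7 := h3 w hw
    have h8 := dist_triangle4 (G w) (G v) (g (φ k) v) (g (φ k) w)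
    rw [dist_comm] at h6 h5
    linarith
  refine ⟨φ, hφ, G, ?_, ?_⟩
  · intro v hv
    obtain ⟨s, hs, hsX, hk, hd⟩ := main v hv (1 / 4) (by norm_num)
    have hcu : ∃ t > 0, t ≤ s ∧ TendstoUniformlyOn (fun k => g (φ k)) G atTop (ball v t) := by
      have hloc : TendstoLocallyUniformlyOn (fun k => g (φ k)) G atTop X := by
        rw [Metric.tendstoLocallyUniformlyOn_iff]
        intro ε hε v hv
        obtain ⟨s, hs, hsX, hk, -⟩ := main v hv ε hε
        exact ⟨ball v s, mem_nhdsWithin_of_mem_nhds (ball_mem_nhds v hs),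
          hk.mono fun k hk w hw => (hk w hw).2⟩
      refine ⟨s / 2, by positivity, by linarith, ?_⟩
      have hc : closedBall v (s / 2) ⊆ X := (closedBall_subset_ball (by linarith)).trans hsX
      exact ((tendstoLocallyUniformlyOn_iff_tendstoUniformlyOn_of_compact
        (isCompact_closedBall v (s / 2))).1 (hloc.mono hc)).mono ball_subset_closedBall
    obtain ⟨t, ht, hts, hu⟩ := hcu
    have hsub : ball v t ⊆ ball v s := ball_subset_ball hts
    rcases unit_or (G v) with ⟨a, ha, hga⟩ | ⟨a, ha, hga⟩
    · left
      exact limHol ht (hk.mono fun k hk w hw => (hk w (hsub hw)).1) hu ha hga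
        (fun y hy => hd y (hsub hy))
    · right
      refine limHol (g := fun k w => sinv (g (φ k) w)) ht
        (hk.mono fun k hk w hw => (hk w (hsub hw)).1.sinv) ?_ ha hga
        (fun y hy => by rw [dist_sinv]; exact hd y (hsub hy))
      rw [Metric.tendstoUniformlyOn_iff] at hu ⊢
      simpa only [dist_sinv] using hu
  · rw [Metric.tendstoLocallyUniformlyOn_iff]
    intro ε hε v hv
    obtain ⟨s, hs, hsX, hk, -⟩ := main v hv ε hε
    exact ⟨ball v s, mem_nhdsWithin_of_mem_nhds (ball_mem_nhds v hs),
      hk.mono fun k hk w hw => (hk w hw).2⟩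

theorem mero_of_hol {X : Set ℂ} (hXc : IsPreconnected X) {G : ℂ → OnePoint ℂ}
    (hH : ∀ v ∈ X, Hol G v) (hne : ∃ v ∈ X, ∃ w ∈ X, G v ≠ G w) : MeromorphicToSphere G X := by
  set A : Set ℂ := {v | ∀ᶠ w in 𝓝 v, G w = ∞} with hA
  have hAo : IsOpen A := isOpen_setOfPred_eventually_nhds
  have hAX : ∀ v ∈ X, v ∉ A := by
    intro v0 hv0 hv0A
    have hsub : X ⊆ A := by
      refine hXc.subset_of_closure_inter_subset hAo ⟨v0, hv0, hv0A⟩ ?_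
      rintro v ⟨hvc, hvX⟩
      rw [mem_closure_iff_frequently] at hvc
      rcases hH v hvX with ⟨h, ha, he⟩ | ⟨h, ha, he⟩
      · obtain ⟨w, hw, hw2⟩ := (hvc.and_eventually he).exists
        have := hw.self_of_nhds
        rw [this] at hw2; exact absurd hw2.symm (OnePoint.coe_ne_infty _)
      · rcases ha.eventually_eq_zero_or_eventually_ne_zero with h0 | h0
        · filter_upwards [h0, he] with w h1 h2
          rw [← sinv_sinv (G w), h2, h1, sinv_zero]
        · rw [eventually_nhdsWithin_iff] at h0
          obtain ⟨w, hw, hw2, hw3⟩ := (hvc.and_eventually (he.and h0)).exists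
          by_cases hwv : w = v
          · rwa [hwv] at hw
          · have := hw.self_of_nhds
            rw [this, sinv_inf] at hw2
            exact absurd (OnePoint.coe_injective hw2).symm (hw3 hwv)
    obtain ⟨v, hv, w, hw, hvw⟩ := hne
    exact hvw ((hsub hv).self_of_nhds.trans (hsub hw).self_of_nhds.symm)
  intro v hv
  rcases hH v hv with ⟨h, ha, he⟩ | ⟨h, ha, he⟩
  · exact ⟨h, ha, Or.inl he⟩
  · by_cases h0 : h v = 0
    · refine ⟨h, ha, Or.inr ⟨?_, h0, ?_⟩⟩
      · rw [← sinv_sinv (G v), he.self_of_nhds, h0, sinv_zero]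
      · rcases ha.eventually_eq_zero_or_eventually_ne_zero with h1 | h1
        · refine absurd ?_ (hAX v hv)
          filter_upwards [h1, he] with w h1 h2
          rw [← sinv_sinv (G w), h2, h1, sinv_zero]
        · filter_upwards [h1, he.filter_mono nhdsWithin_le_nhds] with w h1 h2
          rw [← sinv_sinv (G w), h2, sinv_coe h1]
    · refine ⟨fun w => (h w)⁻¹, ha.inv h0, Or.inl ?_⟩
      filter_upwards [ha.continuousAt.eventually_ne h0, he] with w h1 h2
      rw [← sinv_sinv (G w), h2, sinv_coe h1]

theorem avg_aux {F : ℂ → ℂ} {R m : ℝ} (hR : 0 < R) {c : ℂ} (hF : ContinuousOn F (sphere 0 R))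
    (hm : ∀ z ∈ sphere (0 : ℂ) R, ‖F z - c‖ ≤ m) :
    ‖(∮ z in C(0, R), (z - 0)⁻¹ • F z) - (2 * Real.pi * Complex.I) * c‖ ≤ 2 * Real.pi * m := by
  have hinv : ContinuousOn (fun z : ℂ => (z - 0)⁻¹) (sphere 0 R) := by
    refine ContinuousOn.inv₀ (by fun_prop) ?_
    intro z hz h0
    rw [sub_zero] at h0
    rw [h0, mem_sphere, dist_self] at hz
    exact hR.ne hz
  have h1 : (2 * Real.pi * Complex.I) * c = ∮ z in C(0, R), (z - 0)⁻¹ • c := by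
    have := circleIntegral.integral_sub_center_inv (0 : ℂ) hR.ne'
    rw [circleIntegral.integral_smul_const, this, smul_eq_mul]
  have i1 : CircleIntegrable (fun z => (z - 0)⁻¹ • F z) 0 R :=
    (hinv.smul hF).circleIntegrable hR.le
  have i2 : CircleIntegrable (fun z => (z - 0)⁻¹ • c) 0 R :=
    (hinv.smul continuousOn_const).circleIntegrable hR.le
  rw [h1, ← circleIntegral.integral_sub i1 i2]
  have := circleIntegral.norm_integral_le_of_norm_le_const (c := (0 : ℂ)) (R := R)
    (f := fun z => (z - 0)⁻¹ • F z - (z - 0)⁻¹ • c) (C := R⁻¹ * m) hR.le (by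
      intro z hz
      rw [← smul_sub, norm_smul, norm_inv]
      have h2 := hm z hz
      rw [mem_sphere, dist_eq_norm] at hz
      rw [hz]
      gcongr)
  refine this.trans (le_of_eq ?_)
  field_simp

theorem circle_lim {f : ℂ → OnePoint ℂ} {δ : ℝ} (hδ : 0 < δ)
    (hH : ∀ z, z ≠ 0 → ‖z‖ < δ → Hol f z)
    (hosc : ∀ ε > 0, ∃ η > 0, ∀ a b : ℂ, a ≠ 0 → ‖a‖ = ‖b‖ → ‖a‖ < η → dist (f a) (f b) < ε) :
    ∃ L, Tendsto f (𝓝[≠] 0) (𝓝 L) := by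
  set u : ℝ → OnePoint ℂ := fun t => f (t : ℂ) with hu
  have nrm : ∀ t : ℝ, 0 < t → ‖(t : ℂ)‖ = t := fun t ht => by
    rw [Complex.norm_real, Real.norm_of_nonneg ht.le]
  by_contra hno
  have hnou : ∀ L, ¬ Tendsto u (𝓝[>] 0) (𝓝 L) := by
    intro L hL
    refine hno ⟨L, ?_⟩
    rw [Metric.tendsto_nhdsWithin_nhds] at hL ⊢
    intro ε hε
    obtain ⟨d, hd, h1⟩ := hL (ε / 2) (by positivity)
    obtain ⟨η, hη, h2⟩ := hosc (ε / 2) (by positivity)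
    refine ⟨min d η, by positivity, fun {z} hz hzd => ?_⟩
    have hz0 : z ≠ 0 := hz
    have hzp : 0 < ‖z‖ := norm_pos_iff.2 hz0
    rw [dist_zero_right] at hzd
    have h3 := h1 (x := ‖z‖) hzp (by
      rw [dist_zero_right, norm_norm]; exact hzd.trans_le (min_le_left _ _))
    have h4 := h2 z (‖z‖ : ℂ) hz0 (by rw [nrm _ hzp]) (hzd.trans_le (min_le_right _ _))
    have := dist_triangle (f z) (f (‖z‖ : ℂ)) L
    simp only [hu] at h3
    linarith
  -- a finite cluster value
  obtain ⟨a, ha⟩ : ∃ a : ℂ, MapClusterPt (a : OnePoint ℂ) (𝓝[>] 0) u := by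
    have h1 := hnou ∞
    rw [not_tendsto_iff_exists_frequently_notMem] at h1
    obtain ⟨s, hs, hfr⟩ := h1
    have hc : IsCompact (interior s)ᶜ := isOpen_interior.isClosed_compl.isCompact
    obtain ⟨a, haK, ha⟩ := hc.exists_mapClusterPt_of_frequently
      (hfr.mono fun t ht => fun h => ht (interior_subset h))
    have : a ≠ ∞ := fun h => haK (h ▸ mem_interior_iff_mem_nhds.2 hs)
    obtain ⟨b, rfl⟩ := OnePoint.ne_infty_iff_exists.1 this
    exact ⟨b, ha⟩
  have h1 := hnou a
  rw [not_tendsto_iff_exists_frequently_notMem] at h1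
  obtain ⟨s, hs, hfr⟩ := h1
  obtain ⟨e1, he1, hse1⟩ := Metric.mem_nhds_iff.1 hs
  obtain ⟨e0, he0, hse0⟩ := Metric.mem_nhds_iff.1
    ((OnePoint.isOpenEmbedding_coe (X := ℂ)).image_mem_nhds.2 (ball_mem_nhds a one_pos))
  set e := min e1 (e0 / 2) with he
  have hepos : 0 < e := by positivity
  set C : ℝ := (1 + (‖a‖ + 1)) * (1 + (‖a‖ + 1)) with hC
  have hCpos : 0 < C := by positivity
  set σ := min (e / 2) (e / (8 * C)) with hσ
  have hσpos : 0 < σ := by positivity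
  obtain ⟨η, hη, hosc⟩ := hosc σ hσpos
  -- choose r
  obtain ⟨r, hra, hr0, hrη, hrδ⟩ : ∃ r, dist (u r) a < e / 2 ∧ 0 < r ∧ r < η ∧ r < δ := by
    have h2 := (ha.frequently (ball_mem_nhds _ (half_pos hepos)))
    have h3 : ∀ᶠ r : ℝ in 𝓝[>] 0, 0 < r ∧ r < min η δ :=
      Ioo_mem_nhdsGT (lt_min hη hδ)
    obtain ⟨r, hr1, hr2, hr3⟩ := (h2.and_eventually h3).exists
    exact ⟨r, hr1, hr2, hr3.trans_le (min_le_left _ _), hr3.trans_le (min_le_right _ _)⟩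
  obtain ⟨s0, hs0a, hs00, hs0r⟩ : ∃ s0, e ≤ dist (u s0) a ∧ 0 < s0 ∧ s0 < r := by
    have h3 : ∀ᶠ t : ℝ in 𝓝[>] 0, 0 < t ∧ t < r := Ioo_mem_nhdsGT hr0
    obtain ⟨t, ht1, ht2, ht3⟩ := (hfr.and_eventually h3).exists
    refine ⟨t, ?_, ht2, ht3⟩
    by_contra hlt
    push Not at hlt
    exact ht1 (hse1 (mem_ball.2 (hlt.trans_le (min_le_left _ _))))
  have ucont : ∀ t : ℝ, 0 < t → t < δ → ContinuousAt u t := by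
    intro t ht htδ
    have h2 := (hH t (by exact_mod_cast ht.ne') (by rwa [nrm t ht])).continuousAt
    exact ContinuousAt.comp (f := fun t : ℝ => (t : ℂ)) h2 Complex.continuous_ofReal.continuousAt
  have dcont : ∀ t : ℝ, 0 < t → t < δ → ContinuousAt (fun t => dist (u t) a) t :=
    fun t ht htδ => (ucont t ht htδ).dist continuousAt_const
  set T : Set ℝ := Icc s0 r ∩ {t | e ≤ dist (u t) a} with hT
  have hTc : IsCompact T := by
    refine isCompact_Icc.of_isClosed_subset ?_ inter_subset_left
    have : ContinuousOn (fun t => dist (u t) a) (Icc s0 r) := fun t ht =>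
      (dcont t (hs00.trans_le ht.1) (ht.2.trans_lt hrδ)).continuousWithinAt
    exact this.preimage_isClosed_of_isClosed isClosed_Icc isClosed_Ici
  obtain ⟨t, ⟨⟨hts, htr⟩, hte⟩, htmax⟩ := hTc.exists_isGreatest ⟨s0, ⟨le_rfl, hs0r.le⟩, hs0a⟩
  have hte : e ≤ dist (u t) a := hte
  have ht0 : 0 < t := hs00.trans_le hts
  have htr' : t < r := by
    refine lt_of_le_of_ne htr ?_
    rintro rfl; linarith
  have hgt : ∀ x, t < x → x ≤ r → dist (u x) a < e := by
    intro x hx hxr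
    by_contra hge
    push Not at hge
    exact absurd (htmax ⟨⟨hts.trans hx.le, hxr⟩, hge⟩) (not_le.2 hx)
  have hle : ∀ x, t ≤ x → x ≤ r → dist (u x) a ≤ e := by
    intro x hx hxr
    rcases hx.eq_or_lt with rfl | hx
    · refine le_of_tendsto ((dcont t ht0 (htr'.trans hrδ)).tendsto.mono_left
        (nhdsWithin_le_nhds (s := Ioi t))) ?_
      have : ∀ᶠ x in 𝓝[>] t, t < x ∧ x < r := Ioo_mem_nhdsGT htr'
      filter_upwards [this] with x hx using (hgt x hx.1 hx.2.le).le
    · exact (hgt x hx hxr).le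
  have hfin : ∀ z : ℂ, t ≤ ‖z‖ → ‖z‖ ≤ r → f z = (toC (f z) : OnePoint ℂ) ∧
      ‖toC (f z)‖ ≤ ‖a‖ + 1 := by
    intro z hz1 hz2
    have hzp : 0 < ‖z‖ := ht0.trans_le hz1
    have h4 := hosc z (‖z‖ : ℂ) (norm_pos_iff.1 hzp) (by rw [nrm _ hzp]) (hz2.trans_lt hrη)
    have h5 := hle ‖z‖ hz1 hz2
    have h6 : dist (f z) a < e0 := by
      have := dist_triangle (f z) (f (‖z‖ : ℂ)) a
      have h7 : σ ≤ e / 2 := min_le_left _ _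
      have h8 : e ≤ e0 / 2 := min_le_right _ _
      simp only [hu] at h5
      linarith
    obtain ⟨b, hb, hbz⟩ := hse0 (mem_ball.2 h6)
    rw [← hbz, toC_coe]
    refine ⟨rfl, ?_⟩
    rw [mem_ball, dist_eq_norm] at hb
    have := norm_le_norm_add_norm_sub' b a
    linarith
  have hdiff : ∀ z : ℂ, t ≤ ‖z‖ → ‖z‖ ≤ r → DifferentiableAt ℂ (fun z => toC (f z)) z := by
    intro z hz1 hz2
    have hz := hH z (norm_pos_iff.1 (ht0.trans_le hz1)) (hz2.trans_lt hrδ)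
    refine hz.diff ?_
    have h4 : range ((↑) : ℂ → OnePoint ℂ) ∈ 𝓝 (f z) :=
      OnePoint.isOpen_range_coe.mem_nhds ⟨_, (hfin z hz1 hz2).1.symm⟩
    filter_upwards [hz.continuousAt h4] with w hw
    obtain ⟨b, hb⟩ := hw
    rw [← hb, toC_coe]
  have hint := Complex.circleIntegral_sub_center_inv_smul_eq_of_differentiable_on_annulus_off_countable
    (c := 0) ht0 htr (f := fun z => toC (f z)) (s := ∅) countable_empty
    (by
      intro z hz
      rw [Set.mem_sdiff, mem_closedBall, mem_ball, dist_zero_right, not_lt] at hz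
      exact (hdiff z hz.2 hz.1).continuousAt.continuousWithinAt)
    (by
      intro z hz
      rw [Set.mem_sdiff, Set.mem_sdiff, mem_closedBall, mem_ball, dist_zero_right, not_le] at hz
      exact hdiff z hz.1.2.le hz.1.1.le)
  have hav : ∀ R, t ≤ R → R ≤ r → ‖(∮ z in C(0, R), (z - 0)⁻¹ • toC (f z)) -
      (2 * Real.pi * Complex.I) * toC (f (R : ℂ))‖ ≤ 2 * Real.pi * (C * σ / 2) := by
    intro R hR1 hR2
    have hR0 : 0 < R := ht0.trans_le hR1
    refine avg_aux hR0 ?_ ?_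
    · intro z hz
      rw [mem_sphere, dist_zero_right] at hz
      exact (hdiff z (hz ▸ hR1) (hz ▸ hR2)).continuousAt.continuousWithinAt
    · intro z hz
      rw [mem_sphere, dist_zero_right] at hz
      have h5 := hfin z (hz ▸ hR1) (hz ▸ hR2)
      have h6 := hfin (R : ℂ) (by rwa [nrm R hR0]) (by rwa [nrm R hR0])
      have h7 := dist_cc_le h5.2 h6.2
      rw [← h5.1, ← h6.1, dist_eq_norm] at h7
      have h8 := hosc z R (norm_pos_iff.1 (hz ▸ hR0)) (by rw [hz, nrm R hR0])
        (hz ▸ hR2.trans_lt hrη)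
      have h9 : C * dist (f z) (f (R : ℂ)) ≤ C * σ := by gcongr
      linarith
  have hA := hav t le_rfl htr
  have hB := hav r htr le_rfl
  rw [hint] at hB
  have hAB : 2 * Real.pi * ‖toC (f (t : ℂ)) - toC (f (r : ℂ))‖ ≤ 2 * Real.pi * (C * σ) := by
    have h2 : 2 * Real.pi * ‖toC (f (t : ℂ)) - toC (f (r : ℂ))‖ =
        ‖(2 * Real.pi * Complex.I) * toC (f (t : ℂ)) -
          (2 * Real.pi * Complex.I) * toC (f (r : ℂ))‖ := by
      rw [← mul_sub, norm_mul]
      simp [abs_of_pos Real.pi_pos]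
    rw [h2]
    refine (norm_sub_le_norm_sub_add_norm_sub _
      (∮ z in C(0, t), (z - 0)⁻¹ • toC (f z)) _).trans ?_
    rw [norm_sub_rev] at hA
    linarith
  have hAB2 : ‖toC (f (t : ℂ)) - toC (f (r : ℂ))‖ ≤ C * σ :=
    le_of_mul_le_mul_left hAB (by positivity)
  have h5 := hfin (t : ℂ) (by rw [nrm t ht0]) (by rwa [nrm t ht0])
  have h6 := hfin (r : ℂ) (by rwa [nrm r hr0]) (by rw [nrm r hr0])
  have h7 := dist_le_two_mul (toC (f (t : ℂ))) (toC (f (r : ℂ)))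
  rw [← h5.1, ← h6.1, dist_eq_norm] at h7
  have h8 : C * σ ≤ e / 8 := by
    calc C * σ ≤ C * (e / (8 * C)) := by gcongr; exact min_le_right _ _
      _ = e / 8 := by field_simp
  have h9 := dist_triangle (f (t : ℂ)) (f (r : ℂ)) a
  simp only [hu] at hte hra
  linarith

/-- The conclusion of the main theorem. -/
def Concl (f : ℂ → OnePoint ℂ) : Prop :=
    ∃ X : Set ℂ, (X = Set.univ ∨ X = ({0}ᶜ : Set ℂ)) ∧
      ∃ (g : ℂ → OnePoint ℂ) (x : ℕ → ℂ) (ρ : ℕ → ℝ),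
        MeromorphicToSphere g X ∧ (∃ v ∈ X, ∃ w ∈ X, g v ≠ g w) ∧
        (∀ k, x k ∈ Metric.ball (0 : ℂ) 1 \ {0}) ∧
        Tendsto x atTop (𝓝 (0 : ℂ)) ∧
        (∀ k, 0 < ρ k) ∧ Tendsto ρ atTop (𝓝 (0 : ℝ)) ∧
        ∀ K : Set ℂ, K ⊆ X → IsCompact K → ∀ ε > (0 : ℝ), ∃ M, ∀ k ≥ M, ∀ v ∈ K,
          x k + ρ k * v ∈ Metric.ball (0 : ℂ) 1 \ {0} ∧
          sdist (f (x k + ρ k * v)) (g v) < ε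

theorem Hol.affine {f : ℂ → OnePoint ℂ} {x ρ w : ℂ} (h : Hol f (x + ρ * w)) :
    Hol (fun w => f (x + ρ * w)) w := by
  have hc : ContinuousAt (fun w : ℂ => x + ρ * w) w := by fun_prop
  have han : AnalyticAt ℂ (fun w : ℂ => x + ρ * w) w := by fun_prop
  rcases h with ⟨k, ka, ke⟩ | ⟨k, ka, ke⟩
  · exact Or.inl ⟨fun w => k (x + ρ * w), AnalyticAt.comp (g := k) (f := fun w : ℂ => x + ρ * w) ka han, hc.eventually ke⟩
  · exact Or.inr ⟨fun w => k (x + ρ * w), AnalyticAt.comp (g := k) (f := fun w : ℂ => x + ρ * w) ka han, hc.eventually ke⟩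

theorem finish {f : ℂ → OnePoint ℂ} {δ : ℝ} (hδ : δ ≤ 1)
    (hH : ∀ z, z ≠ 0 → ‖z‖ < δ → Hol f z) {X : Set ℂ}
    (hX : X = Set.univ ∨ X = ({0}ᶜ : Set ℂ)) (x : ℕ → ℂ) (ρ : ℕ → ℝ)
    (hx : ∀ k, x k ∈ Metric.ball (0 : ℂ) 1 \ {0}) (hx0 : Tendsto x atTop (𝓝 (0 : ℂ)))
    (hρ : ∀ k, 0 < ρ k) (hρ0 : Tendsto ρ atTop (𝓝 (0 : ℝ)))
    (H : ∀ v ∈ X, ∃ r > 0, ∀ᶠ k in atTop, ∀ w ∈ ball v r,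
      (x k + ρ k * w ≠ 0 ∧ ‖x k + ρ k * w‖ < δ) ∧
        dist (f (x k + ρ k * w)) (f (x k + ρ k * v)) ≤ 1 / 2)
    {Q : Set ℂ} (hQX : Q ⊆ X) (hQ : IsCompact Q) {ε : ℝ} (hε : 0 < ε)
    (hne : ∀ k, ∃ a ∈ Q, ∃ b ∈ Q,
      ε ≤ dist (f (x k + ρ k * a)) (f (x k + ρ k * b))) : Concl f := by
  have hXo : IsOpen X := by
    rcases hX with rfl | rfl
    · exact isOpen_univ
    · exact isOpen_compl_singleton
  have hXc : IsPreconnected X := by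
    rcases hX with rfl | rfl
    · exact isPreconnected_univ
    · exact (isConnected_compl_singleton_of_one_lt_rank (by simp) _).isPreconnected
  obtain ⟨φ, hφ, G, hG, hlim⟩ := normal_seq hXo (fun k w => f (x k + ρ k * w)) (by
    intro v hv
    obtain ⟨r, hr, hk⟩ := H v hv
    refine ⟨r, hr, hk.mono fun k hk w hw => ⟨?_, (hk w hw).2⟩⟩
    exact (hH _ (hk w hw).1.1 (hk w hw).1.2).affine)
  have hcomp : ∀ K ⊆ X, IsCompact K → ∀ ε > 0, ∀ᶠ k in atTop, ∀ v ∈ K,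
      dist (G v) (f (x (φ k) + ρ (φ k) * v)) < ε := by
    intro K hKX hK
    exact Metric.tendstoUniformlyOn_iff.1
      ((tendstoLocallyUniformlyOn_iff_tendstoUniformlyOn_of_compact hK).1 (hlim.mono hKX))
  have hnc : ∃ v ∈ X, ∃ w ∈ X, G v ≠ G w := by
    by_contra hcon
    push Not at hcon
    obtain ⟨k, hk⟩ := (hcomp Q hQX hQ (ε / 2) (by positivity)).exists
    obtain ⟨a, ha, b, hb, hab⟩ := hne (φ k)
    have h1 := hk a ha
    have h2 := hk b hb
    rw [hcon a (hQX ha) b (hQX hb)] at h1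
    have := dist_triangle_left (f (x (φ k) + ρ (φ k) * a)) (f (x (φ k) + ρ (φ k) * b)) (G b)
    linarith
  refine ⟨X, hX, G, fun k => x (φ k), fun k => ρ (φ k), mero_of_hol hXc hG hnc, hnc,
    fun k => hx _, hx0.comp hφ.tendsto_atTop, fun k => hρ _, hρ0.comp hφ.tendsto_atTop, ?_⟩
  intro K hKX hK ε hε
  have hmem : ∀ᶠ k in atTop, ∀ v ∈ K,
      x (φ k) + ρ (φ k) * v ∈ Metric.ball (0 : ℂ) 1 \ {0} := by
    refine hφ.tendsto_atTop.eventually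
      (p := fun k => ∀ v ∈ K, x k + ρ k * v ∈ Metric.ball (0 : ℂ) 1 \ {0}) ?_
    refine hK.induction_on
      (p := fun K => ∀ᶠ k in atTop, ∀ v ∈ K, x k + ρ k * v ∈ Metric.ball (0 : ℂ) 1 \ {0})
      (by simp) ?_ ?_ ?_
    · intro s t hst ht
      exact ht.mono fun k hk v hv => hk v (hst hv)
    · intro s t hs ht
      filter_upwards [hs, ht] with k h1 h2 v hv
      exact hv.elim (h1 v) (h2 v)
    · intro v hv
      obtain ⟨r, hr, hk⟩ := H v (hKX hv)
      refine ⟨ball v r, mem_nhdsWithin_of_mem_nhds (ball_mem_nhds v hr), ?_⟩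
      filter_upwards [hk] with k hk w hw
      refine ⟨?_, (hk w hw).1.1⟩
      rw [mem_ball, dist_zero_right]
      exact (hk w hw).1.2.trans_le hδ
  obtain ⟨M, hM⟩ := eventually_atTop.1 (hmem.and (hcomp K hKX hK ε hε))
  refine ⟨M, fun k hk v hv => ⟨(hM k hk).1 v hv, ?_⟩⟩
  rw [← dist_sph, dist_comm]
  exact (hM k hk).2 v hv

theorem caseA_step {f : ℂ → OnePoint ℂ} {δ : ℝ} (hδ : 0 < δ)
    (hH : ∀ z, z ≠ 0 → ‖z‖ < δ → Hol f z)
    (hA : ∀ c > 0, ∀ η > 0, ∃ z : ℂ, z ≠ 0 ∧ ‖z‖ < η ∧ ∃ w ∈ ball z (c * ‖z‖),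
      1 / 2 < dist (f w) (f z)) {N : ℝ} (hN : 1 ≤ N) :
    ∃ (y : ℂ) (R : ℝ), 0 < R ∧ R < 1 / N ∧ y ≠ 0 ∧ ‖y‖ < 1 / N ∧
      (∀ w, ‖w - y‖ ≤ N * R → w ≠ 0 ∧ ‖w‖ < δ ∧
        ∀ u ∈ ball w (R / 2), dist (f u) (f w) ≤ 1 / 2) ∧
      ∃ u ∈ ball y (2 * R), 1 / 2 < dist (f u) (f y) := by
  have hN0 : 0 < N := by linarith
  obtain ⟨z, hz0, hzη, w0, hw0, hw0d⟩ := hA (1 / (4 * N)) (by positivity)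
    (min δ (1 / N) / 2) (by positivity)
  have hzp : 0 < ‖z‖ := norm_pos_iff.2 hz0
  set d := ‖z‖ / 2 with hd
  have hdp : 0 < d := by positivity
  have hin : ∀ w ∈ closedBall z d, 0 < ‖w‖ ∧ ‖w‖ < δ ∧ ‖w‖ < 1 / N := by
    intro w hw
    rw [mem_closedBall, dist_eq_norm] at hw
    have h1 := norm_le_norm_add_norm_sub' w z
    have h2 := norm_le_norm_add_norm_sub' z w
    rw [norm_sub_rev] at h2
    have h3 : min δ (1 / N) ≤ δ := min_le_left _ _
    have h4 : min δ (1 / N) ≤ 1 / N := min_le_right _ _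
    refine ⟨by linarith, by linarith, by linarith⟩
  have hfc : ContinuousOn f (closedBall z d) := fun w hw =>
    (hH w (norm_pos_iff.1 (hin w hw).1) (hin w hw).2.1).continuousAt.continuousWithinAt
  have huc := (isCompact_closedBall z d).uniformContinuousOn_of_continuous hfc
  rw [Metric.uniformContinuousOn_iff] at huc
  obtain ⟨r0, hr0, huc⟩ := huc (1 / 2) (by norm_num)
  set T : ℝ → Prop := fun m => ∀ w ∈ ball z d, ∀ u ∈ ball w (m * (d - dist w z)),
    dist (f u) (f w) ≤ 1 / 2 with hT
  have hT1 : T (min 1 (r0 / d)) := by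
    intro w hw u hu
    rw [mem_ball] at hw hu
    have hpos : 0 ≤ d - dist w z := by linarith
    have h1 : dist u w < 1 * (d - dist w z) :=
      hu.trans_le (by gcongr; exact min_le_left _ _)
    have h2 : dist u w < (r0 / d) * d := by
      refine hu.trans_le ?_
      gcongr
      · exact min_le_right _ _
      · linarith [dist_nonneg (x := w) (y := z)]
    rw [div_mul_cancel₀ _ hdp.ne'] at h2
    refine (huc u ?_ w ?_ h2).le
    · rw [mem_closedBall]; linarith [dist_triangle u w z]
    · rw [mem_closedBall]; exact hw.le
  have hTb : ∀ m, T m → m < 1 / (2 * N) := by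
    intro m hm
    by_contra hge
    push Not at hge
    have h1 := hm z (mem_ball_self hdp) w0 (by
      rw [mem_ball] at hw0 ⊢
      refine hw0.trans_le ?_
      rw [dist_self, sub_zero]
      calc 1 / (4 * N) * ‖z‖ = 1 / (2 * N) * d := by rw [hd]; field_simp; norm_num
        _ ≤ m * d := by gcongr)
    linarith
  obtain ⟨m, hm0, hm, hm2⟩ : ∃ m > 0, T m ∧ ¬ T (2 * m) := by
    by_contra hcon
    push Not at hcon
    have hm1 : 0 < min 1 (r0 / d) := by positivity
    have hall : ∀ n : ℕ, T (2 ^ n * min 1 (r0 / d)) := by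
      intro n
      induction n with
      | zero => simpa using hT1
      | succ n ih =>
        have := hcon _ (by positivity) ih
        rwa [← mul_assoc, ← pow_succ'] at this
    obtain ⟨n, hn⟩ := pow_unbounded_of_one_lt (1 / (2 * N) / min 1 (r0 / d)) one_lt_two
    rw [div_lt_iff₀ hm1] at hn
    linarith [hTb _ (hall n)]
  have hmb := hTb m hm
  rw [lt_div_iff₀ (by positivity)] at hmb
  simp only [hT] at hm2
  push Not at hm2
  obtain ⟨y, hy, u, hu, hud⟩ := hm2
  rw [mem_ball] at hy
  set D := d - dist y z with hD
  have hDp : 0 < D := by linarith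
  have hDd : D ≤ d := by linarith [dist_nonneg (x := y) (y := z)]
  have hNR : N * (m * D) ≤ D / 2 := by nlinarith
  have hyin := hin y (mem_closedBall.2 hy.le)
  have hzin := hin z (mem_closedBall_self hdp.le)
  refine ⟨y, m * D, by positivity, ?_, norm_pos_iff.1 hyin.1, hyin.2.2, ?_, u, ?_, hud⟩
  · have h1 : m * D ≤ N * (m * D) := le_mul_of_one_le_left (by positivity) hN
    linarith
  · intro w hw
    rw [← dist_eq_norm] at hw
    have hwz : dist w z ≤ d - D / 2 := by linarith [dist_triangle w y z]
    have hwb : w ∈ ball z d := by rw [mem_ball]; linarith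
    have hwin := hin w (ball_subset_closedBall hwb)
    refine ⟨norm_pos_iff.1 hwin.1, hwin.2.1, fun u hu => hm w hwb u ?_⟩
    refine ball_subset_ball ?_ hu
    have : D / 2 ≤ d - dist w z := by linarith
    calc m * D / 2 = m * (D / 2) := by ring
      _ ≤ _ := by gcongr
  · rwa [mul_assoc] at hu

theorem caseA {f : ℂ → OnePoint ℂ} {δ : ℝ} (hδ : 0 < δ) (hδ1 : δ ≤ 1)
    (hH : ∀ z, z ≠ 0 → ‖z‖ < δ → Hol f z)
    (hA : ∀ c > 0, ∀ η > 0, ∃ z : ℂ, z ≠ 0 ∧ ‖z‖ < η ∧ ∃ w ∈ ball z (c * ‖z‖),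
      1 / 2 < dist (f w) (f z)) : Concl f := by
  have hN : ∀ n : ℕ, (1 : ℝ) ≤ n + 1 := fun n => by
    have : (0 : ℝ) ≤ n := n.cast_nonneg
    linarith
  choose y R hR hR1 hy hy1 hloc hne using fun n : ℕ => caseA_step hδ hH hA (hN n)
  refine finish hδ1 hH (Or.inl rfl) y R ?_ ?_ hR ?_ ?_ (subset_univ (closedBall 0 2))
    (isCompact_closedBall 0 2) (ε := 1 / 2) (by norm_num) ?_
  · intro k
    refine ⟨?_, hy k⟩
    rw [mem_ball, dist_zero_right]
    exact (hy1 k).trans_le ((div_le_one (by linarith [hN k])).2 (hN k))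
  · exact squeeze_zero_norm (fun k => (hy1 k).le) tendsto_one_div_add_atTop_nhds_zero_nat
  · exact squeeze_zero (fun k => (hR k).le) (fun k => (hR1 k).le)
      tendsto_one_div_add_atTop_nhds_zero_nat
  · intro v _
    refine ⟨1 / 2, by norm_num, ?_⟩
    have hev : ∀ᶠ k : ℕ in atTop, ‖v‖ + 1 / 2 ≤ (k : ℝ) :=
      tendsto_natCast_atTop_atTop.eventually (eventually_ge_atTop _)
    filter_upwards [hev] with k hk w hw
    rw [mem_ball, dist_eq_norm] at hw
    have hnR : ‖((R k : ℝ) : ℂ)‖ = R k := by rw [Complex.norm_real, Real.norm_of_nonneg (hR k).le]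
    have hwn : ‖w‖ ≤ k + 1 := by
      have := norm_le_norm_add_norm_sub' w v
      linarith
    have h1 := hloc k (y k + R k * w) (by
      rw [add_sub_cancel_left, norm_mul, hnR, mul_comm]
      exact mul_le_mul_of_nonneg_right hwn (hR k).le)
    have h2 := hloc k (y k + R k * v) (by
      rw [add_sub_cancel_left, norm_mul, hnR, mul_comm]
      exact mul_le_mul_of_nonneg_right (by linarith) (hR k).le)
    refine ⟨⟨h1.1, h1.2.1⟩, h2.2.2 _ ?_⟩
    rw [mem_ball, dist_eq_norm, add_sub_add_left_eq_sub, ← mul_sub, norm_mul, hnR]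
    have := mul_lt_mul_of_pos_left hw (hR k)
    linarith
  · intro k
    obtain ⟨u, hu, hud⟩ := hne k
    have hR0 : ((R k : ℝ) : ℂ) ≠ 0 := by exact_mod_cast (hR k).ne'
    refine ⟨(u - y k) / R k, ?_, 0, by simp, ?_⟩
    · rw [mem_ball, dist_eq_norm] at hu
      rw [mem_closedBall, dist_zero_right, norm_div, Complex.norm_real,
        Real.norm_of_nonneg (hR k).le, div_le_iff₀ (hR k)]
      exact hu.le
    · rw [mul_div_cancel₀ _ hR0, mul_zero, add_zero, add_sub_cancel]
      exact hud.le

theorem caseB {f : ℂ → OnePoint ℂ} {δ : ℝ} (hδ1 : δ ≤ 1)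
    (hH : ∀ z, z ≠ 0 → ‖z‖ < δ → Hol f z) {c η : ℝ} (hc : 0 < c) (hη : 0 < η) (hηδ : η ≤ δ)
    (hB : ∀ z : ℂ, z ≠ 0 → ‖z‖ < η → ∀ w ∈ ball z (c * ‖z‖), dist (f w) (f z) ≤ 1 / 2)
    {ε : ℝ} (hε : 0 < ε)
    (hosc : ∀ η > 0, ∃ a b : ℂ, a ≠ 0 ∧ ‖a‖ = ‖b‖ ∧ ‖a‖ < η ∧ ε ≤ dist (f a) (f b)) :
    Concl f := by
  have hn0 : ∀ n : ℕ, (0 : ℝ) < n + 1 := fun n => by positivity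
  have hn1 : ∀ n : ℕ, (1 : ℝ) / (n + 1) ≤ 1 := fun n => by
    rw [div_le_one (hn0 n)]
    have : (0 : ℝ) ≤ n := n.cast_nonneg
    linarith
  choose a b ha hab ha1 hd using fun n : ℕ => hosc (1 / ((n : ℝ) + 1)) (by positivity)
  set ρ : ℕ → ℝ := fun n => ‖a n‖ with hρdef
  have hρ : ∀ n, 0 < ρ n := fun n => norm_pos_iff.2 (ha n)
  have hρ0 : Tendsto ρ atTop (𝓝 0) := squeeze_zero (fun k => (hρ k).le) (fun k => (ha1 k).le)
      tendsto_one_div_add_atTop_nhds_zero_nat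
  set s : ℕ → ℝ := fun n => 1 / ((n : ℝ) + 1) / 2 with hs
  have hspos : ∀ n, 0 < s n := fun n => by positivity
  have hs2 : ∀ n, s n ≤ 1 / 2 := fun n => by have := hn1 n; simp only [hs]; linarith
  have hs0 : Tendsto s atTop (𝓝 0) := by
    have h := (tendsto_one_div_add_atTop_nhds_zero_nat (𝕜 := ℝ)).div_const 2
    rwa [zero_div] at h
  set x : ℕ → ℂ := fun n => ((ρ n * s n : ℝ) : ℂ) with hx
  have hxn : ∀ n, ‖x n‖ = ρ n * s n := fun n => by
    rw [hx, Complex.norm_real, Real.norm_of_nonneg (mul_pos (hρ n) (hspos n)).le]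
  have hnρ : ∀ n, ‖((ρ n : ℝ) : ℂ)‖ = ρ n := fun n => by
    rw [Complex.norm_real, Real.norm_of_nonneg (hρ n).le]
  refine finish hδ1 hH (Or.inr rfl) x ρ ?_ ?_ hρ hρ0 ?_
    (Q := closedBall 0 2 \ ball 0 (1 / 2)) ?_
    ((isCompact_closedBall 0 2).diff isOpen_ball) hε ?_
  · intro k
    refine ⟨?_, ?_⟩
    · rw [mem_ball, dist_zero_right, hxn]
      have h1 := (ha1 k).trans_le (hn1 k)
      have h2 := hs2 k
      have h3 := hspos k
      have h4 := hρ k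
      simp only [hρdef] at h4 ⊢
      nlinarith
    · have : ‖x k‖ ≠ 0 := by rw [hxn]; exact (mul_pos (hρ k) (hspos k)).ne'
      exact norm_ne_zero_iff.1 this
  · rw [tendsto_zero_iff_norm_tendsto_zero]
    simp_rw [hxn]
    simpa using hρ0.mul hs0
  · intro v hv
    have hvp : 0 < ‖v‖ := norm_pos_iff.2 hv
    refine ⟨min (c / 4) (1 / 4) * ‖v‖, by positivity, ?_⟩
    have e1 : ∀ᶠ k in atTop, s k < ‖v‖ / 4 := hs0.eventually_lt_const (by positivity)
    have e2 : ∀ᶠ k in atTop, ρ k < η / (2 * ‖v‖) := hρ0.eventually_lt_const (by positivity)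
    filter_upwards [e1, e2] with k h1 h2 w hw
    rw [lt_div_iff₀ (by positivity)] at h2
    rw [mem_ball, dist_eq_norm] at hw
    have hw1 : ‖w - v‖ < c / 4 * ‖v‖ := hw.trans_le (by gcongr; exact min_le_left _ _)
    have hw2 : ‖w - v‖ < 1 / 4 * ‖v‖ := hw.trans_le (by gcongr; exact min_le_right _ _)
    have hx1 : ‖x k‖ ≤ ρ k * (‖v‖ / 4) := by
      rw [hxn]; exact mul_le_mul_of_nonneg_left h1.le (hρ k).le
    have hlow : ∀ w : ℂ, ρ k * ‖w‖ - ‖x k‖ ≤ ‖x k + ρ k * w‖ := by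
      intro w
      have := norm_sub_le_norm_add (ρ k * w : ℂ) (x k)
      rw [norm_mul, hnρ, add_comm (_ * _)] at this
      exact this
    have hup : ∀ w : ℂ, ‖x k + ρ k * w‖ ≤ ‖x k‖ + ρ k * ‖w‖ := by
      intro w
      have := norm_add_le (x k) (ρ k * w : ℂ)
      rwa [norm_mul, hnρ] at this
    have hρv : 0 < ρ k * ‖v‖ := mul_pos (hρ k) hvp
    have hwl : ρ k * (3 / 4 * ‖v‖) ≤ ρ k * ‖w‖ := by
      refine mul_le_mul_of_nonneg_left ?_ (hρ k).le
      have := norm_le_norm_add_norm_sub' v w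
      rw [norm_sub_rev] at this
      linarith
    have hwu : ρ k * ‖w‖ ≤ ρ k * (5 / 4 * ‖v‖) := by
      refine mul_le_mul_of_nonneg_left ?_ (hρ k).le
      have := norm_le_norm_add_norm_sub' w v
      linarith
    have hlv := hlow v
    have huv := hup v
    have hlw := hlow w
    have huw := hup w
    refine ⟨⟨norm_pos_iff.1 (by linarith), by linarith⟩, ?_⟩
    refine hB _ (norm_pos_iff.1 (by linarith)) (by linarith) _ ?_
    rw [mem_ball, dist_eq_norm, add_sub_add_left_eq_sub, ← mul_sub, norm_mul, hnρ]
    calc ρ k * ‖w - v‖ < ρ k * (c / 4 * ‖v‖) := mul_lt_mul_of_pos_left hw1 (hρ k)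
      _ = c * (ρ k * ‖v‖ / 4) := by ring
      _ ≤ c * ‖x k + ρ k * v‖ := by gcongr; linarith
  · rintro v ⟨-, hv⟩ h0
    rw [mem_singleton_iff] at h0
    exact hv (by rw [h0]; simp)
  · intro k
    have hR0 : ((ρ k : ℝ) : ℂ) ≠ 0 := by exact_mod_cast (hρ k).ne'
    have key : ∀ u : ℂ, ‖u‖ = ρ k →
        (u - x k) / ρ k ∈ closedBall (0 : ℂ) 2 \ ball 0 (1 / 2) ∧
        x k + ρ k * ((u - x k) / ρ k) = u := by
      intro u hu
      refine ⟨⟨?_, ?_⟩, ?_⟩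
      · rw [mem_closedBall, dist_zero_right, norm_div, hnρ, div_le_iff₀ (hρ k)]
        have h1 := norm_sub_le u (x k)
        rw [hxn] at h1
        have := mul_le_mul_of_nonneg_left (hs2 k) (hρ k).le
        linarith [hρ k]
      · rw [mem_ball, dist_zero_right, norm_div, hnρ, div_lt_iff₀ (hρ k), not_lt]
        have h1 := norm_sub_norm_le u (x k)
        rw [hxn] at h1
        have := mul_le_mul_of_nonneg_left (hs2 k) (hρ k).le
        linarith [hρ k]
      · rw [mul_div_cancel₀ _ hR0, add_sub_cancel]
    refine ⟨_, (key (a k) rfl).1, _, (key (b k) (hab k).symm).1, ?_⟩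
    rw [(key (a k) rfl).2, (key (b k) (hab k).symm).2]
    exact hd k

theorem caseJ {f : ℂ → OnePoint ℂ}
    (hJ : ∀ η > 0, ∃ z : ℂ, z ≠ 0 ∧ ‖z‖ < η ∧ f z = ∞ ∧
      ∀ᶠ w in 𝓝[≠] z, f w = ((0 : ℂ) : OnePoint ℂ)) : Concl f := by
  have hn0 : ∀ n : ℕ, (0 : ℝ) < n + 1 := fun n => by positivity
  have hn1 : ∀ n : ℕ, (1 : ℝ) / (n + 1) ≤ 1 := fun n => by
    rw [div_le_one (hn0 n)]
    have : (0 : ℝ) ≤ n := n.cast_nonneg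
    linarith
  choose x hx0 hx1 hxf hxe using fun n : ℕ => hJ (1 / ((n : ℝ) + 1)) (by positivity)
  have hD : ∀ n, x n ∈ ball (0 : ℂ) 1 \ {0} := fun n =>
    ⟨by rw [mem_ball, dist_zero_right]; exact (hx1 n).trans_le (hn1 n), hx0 n⟩
  have hDo : IsOpen (ball (0 : ℂ) 1 \ {0}) := isOpen_ball.sdiff isClosed_singleton
  have ht : ∀ n, ∃ t > 0, ∀ w ∈ ball (x n) t, w ∈ ball (0 : ℂ) 1 \ {0} ∧
      (w ≠ x n → f w = ((0 : ℂ) : OnePoint ℂ)) := by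
    intro n
    have h1 := eventually_nhdsWithin_iff.1 (hxe n)
    have h2 := hDo.mem_nhds (hD n)
    obtain ⟨t, ht, h3⟩ := Metric.eventually_nhds_iff_ball.1 (h1.and h2)
    exact ⟨t, ht, fun w hw => ⟨(h3 w hw).2, (h3 w hw).1⟩⟩
  choose t ht htb using ht
  set ρ : ℕ → ℝ := fun n => min (t n) 1 / ((n : ℝ) + 1) with hρdef
  have hρ : ∀ n, 0 < ρ n := fun n => div_pos (lt_min (ht n) one_pos) (hn0 n)
  classical
  refine ⟨univ, Or.inl rfl, fun v => if v = 0 then ∞ else ((0 : ℂ) : OnePoint ℂ), x, ρ, ?_, ?_, hD,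
    ?_, hρ, ?_, ?_⟩
  · intro v _
    refine ⟨fun _ => 0, analyticAt_const, ?_⟩
    by_cases hv : v = 0
    · right
      refine ⟨by simp [hv], rfl, ?_⟩
      rw [hv]
      filter_upwards [self_mem_nhdsWithin] with w hw
      have hw : w ≠ 0 := hw
      simp [hw]
    · left
      filter_upwards [isOpen_compl_singleton.mem_nhds (show v ∈ ({0}ᶜ : Set ℂ) from hv)] with w hw
      have hw : w ≠ 0 := hw
      simp [hw]
  · exact ⟨0, mem_univ _, 1, mem_univ _, by simp⟩
  · exact squeeze_zero_norm (fun k => (hx1 k).le) tendsto_one_div_add_atTop_nhds_zero_nat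
  · refine squeeze_zero (fun k => (hρ k).le) (fun k => ?_)
      (tendsto_one_div_add_atTop_nhds_zero_nat (𝕜 := ℝ))
    exact div_le_div_of_nonneg_right (min_le_right _ _) (hn0 k).le
  · intro K _ hK ε hε
    obtain ⟨B, hB⟩ := hK.isBounded.exists_norm_le
    obtain ⟨M, hM⟩ := exists_nat_ge B
    refine ⟨M, fun k hk v hv => ?_⟩
    have hR0 : ((ρ k : ℝ) : ℂ) ≠ 0 := by exact_mod_cast (hρ k).ne'
    have hmem : x k + ρ k * v ∈ ball (x k) (t k) := by
      rw [mem_ball, dist_eq_norm, add_sub_cancel_left, norm_mul, Complex.norm_real,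
        Real.norm_of_nonneg (hρ k).le]
      have h1 : ‖v‖ < (k : ℝ) + 1 := by
        have h2 := hB v hv
        have h3 : (M : ℝ) ≤ k := by exact_mod_cast hk
        linarith
      calc ρ k * ‖v‖ < ρ k * (k + 1) := mul_lt_mul_of_pos_left h1 (hρ k)
        _ = min (t k) 1 := div_mul_cancel₀ _ (hn0 k).ne'
        _ ≤ t k := min_le_left _ _
    refine ⟨(htb k _ hmem).1, ?_⟩
    rw [← dist_sph]
    by_cases hv0 : v = 0
    · simp [hv0, hxf k, hε]
    · rw [(htb k _ hmem).2 (by simp [hv0, hR0])]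
      simp [hv0, hε]

theorem main_aux (f : ℂ → OnePoint ℂ)
    (hf : MeromorphicToSphere f (Metric.ball (0 : ℂ) 1 \ {0}))
    (hess : ¬ ∃ L : OnePoint ℂ,
      Tendsto f (𝓝[Metric.ball (0 : ℂ) 1 \ {0}] 0) (𝓝 L)) : Concl f := by
  by_cases hJ : ∀ η > 0, ∃ z : ℂ, z ≠ 0 ∧ ‖z‖ < η ∧ f z = ∞ ∧
      ∀ᶠ w in 𝓝[≠] z, f w = ((0 : ℂ) : OnePoint ℂ)
  · exact caseJ hJ
  push Not at hJ
  obtain ⟨η, hη, hJ⟩ := hJ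
  set δ := min η 1 with hδ
  have hδ0 : 0 < δ := by positivity
  have hδ1 : δ ≤ 1 := min_le_right _ _
  have hH : ∀ z, z ≠ 0 → ‖z‖ < δ → Hol f z := by
    intro z hz hzδ
    obtain ⟨h, ha, he | ⟨h1, h2, h3⟩⟩ := hf z
      ⟨by rw [mem_ball, dist_zero_right]; exact hzδ.trans_le hδ1, hz⟩
    · exact Or.inl ⟨h, ha, he⟩
    · right
      refine ⟨h, ha, ?_⟩
      rcases ha.eventually_eq_zero_or_eventually_ne_zero with h0 | h0
      · refine absurd ?_ (hJ z hz (hzδ.trans_le (min_le_left _ _)) h1)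
        filter_upwards [h3, h0.filter_mono nhdsWithin_le_nhds] with w h4 h5
        rw [h4, h5, inv_zero]
        exact fun h => h rfl
      · have h6 := eventually_nhdsWithin_iff.1 (h3.and h0)
        filter_upwards [h6] with w hw
        by_cases hwz : w = z
        · rw [hwz, h1, h2, sinv_inf]
        · obtain ⟨h7, h8⟩ := hw hwz
          rw [h7, sinv_coe (inv_ne_zero h8), inv_inv]
  by_cases hA : ∀ c > 0, ∀ η > 0, ∃ z : ℂ, z ≠ 0 ∧ ‖z‖ < η ∧ ∃ w ∈ ball z (c * ‖z‖),
      1 / 2 < dist (f w) (f z)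
  · exact caseA hδ0 hδ1 hH hA
  push Not at hA
  obtain ⟨c, hc, η', hη', hB⟩ := hA
  by_cases hosc : ∀ ε > 0, ∃ η > 0, ∀ a b : ℂ, a ≠ 0 → ‖a‖ = ‖b‖ → ‖a‖ < η →
      dist (f a) (f b) < ε
  · obtain ⟨L, hL⟩ := circle_lim hδ0 hH hosc
    exact absurd ⟨L, hL.mono_left (nhdsWithin_mono _ fun z hz => hz.2)⟩ hess
  push Not at hosc
  obtain ⟨ε, hε, hosc⟩ := hosc
  exact caseB hδ1 hH hc (lt_min hη' hδ0) (min_le_right _ _)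
    (fun z hz hzm => hB z hz (hzm.trans_le (min_le_left _ _))) hε hosc

end Sphere


theorem rescaling_at_essential_singularity_planar
    (f : ℂ → OnePoint ℂ)
    (hf : MeromorphicToSphere f (Metric.ball (0 : ℂ) 1 \ {0}))
    (hess : ¬ ∃ L : OnePoint ℂ,
      Tendsto f (𝓝[Metric.ball (0 : ℂ) 1 \ {0}] 0) (𝓝 L)) :
    ∃ X : Set ℂ, (X = Set.univ ∨ X = ({0}ᶜ : Set ℂ)) ∧
      ∃ (g : ℂ → OnePoint ℂ) (x : ℕ → ℂ) (ρ : ℕ → ℝ),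
        MeromorphicToSphere g X ∧ (∃ v ∈ X, ∃ w ∈ X, g v ≠ g w) ∧
        (∀ k, x k ∈ Metric.ball (0 : ℂ) 1 \ {0}) ∧
        Tendsto x atTop (𝓝 (0 : ℂ)) ∧
        (∀ k, 0 < ρ k) ∧ Tendsto ρ atTop (𝓝 (0 : ℝ)) ∧
        ∀ K : Set ℂ, K ⊆ X → IsCompact K → ∀ ε > (0 : ℝ), ∃ M, ∀ k ≥ M, ∀ v ∈ K,
          x k + ρ k * v ∈ Metric.ball (0 : ℂ) 1 \ {0} ∧
          sdist (f (x k + ρ k * v)) (g v) < ε := by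
  exact main_aux f hf hess
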